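/- arXiv:2310.16189 — 3 statements merged into one kernel-verified Lean document; each statement's English description precedes it below -/
import Mathlib

section
/- Let φ : ℝ → ℝ be differentiable and let γ : ℝ → ℝ be a Lipschitz continuous, strictly monotone increasing function with γ(0) = 0. If φ(0) ≥ 0 and the derivative satisfies φ'(t) ≥ −γ(φ(t)) for all t ≥ 0, then φ(t) ≥ 0 for all t ≥ 0. (This is the forward-invariance part of the Control Barrier Function theorem: along any trajectory of the closed-loop system, the value φ(t) = h(σ(t), t) of the barrier function remains nonnegative, i.e., the set C = {σ : h(σ,t) ≥ 0} is forward invariant.) -/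
/-- Forward-invariance part of the Control Barrier Function theorem:
if `φ(0) ≥ 0` and `φ'(t) ≥ -γ(φ(t))` for all `t ≥ 0`, where `γ` is a Lipschitz
continuous, strictly monotone increasing function with `γ(0) = 0`, then
`φ(t) ≥ 0` for all `t ≥ 0`. -/
theorem cbf_forward_invariance
    (φ γ : ℝ → ℝ)
    (hφ : Differentiable ℝ φ)
    (K : NNReal) (hγ_lip : LipschitzWith K γ)
    (hγ_mono : StrictMono γ)
    (hγ_zero : γ 0 = 0)
    (h0 : φ 0 ≥ 0)
    (hineq : ∀ t ≥ (0 : ℝ), deriv φ t ≥ -γ (φ t)) :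
    ∀ t ≥ (0 : ℝ), φ t ≥ 0 := by
  intro t ht
  refine le_of_forall_pos_sub_le fun ε hε => ?_
  have hγ_neg : γ (-ε) < 0 := hγ_zero ▸ hγ_mono (neg_lt_zero.mpr hε)
  have key : -φ t ≤ ε :=
    image_le_of_deriv_right_lt_deriv_boundary (f := fun x => -φ x) (f' := fun x => -deriv φ x)
      (a := 0) (b := t) (B := fun _ => ε) (B' := fun _ => 0) hφ.continuous.neg.continuousOn
      (fun x _ => (hφ x).hasDerivAt.neg.hasDerivWithinAt) (by linarith)
      (fun x => hasDerivAt_const x ε)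
      (fun x hx hxε => by
        have hφx : φ x = -ε := by linarith
        have hderiv := hineq x hx.1
        rw [hφx] at hderiv
        linarith)
      (Set.right_mem_Icc.mpr ht)
  linarith
end

section
/- Let φ : ℝ → ℝ be differentiable and let γ : ℝ → ℝ be a Lipschitz continuous, strictly monotone increasing function with γ(0) = 0. If φ'(t) ≥ −γ(φ(t)) for all t ≥ 0, then for every ε > 0 there exists T ≥ 0 such that φ(t) > −ε for all t ≥ T. (This is the asymptotic-stability part of the Control Barrier Function theorem: the set C = {σ : h(σ,t) ≥ 0} is asymptotically stable, since the value of the barrier function along any trajectory eventually exceeds every negative level.) -/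
/-- Asymptotic-stability part of the Control Barrier Function theorem:
if `φ'(t) ≥ -γ(φ(t))` for all `t ≥ 0`, where `γ` is a Lipschitz continuous,
strictly monotone increasing function with `γ(0) = 0`, then for every `ε > 0`
there is `T ≥ 0` such that `φ(t) > -ε` for all `t ≥ T`. -/
theorem cbf_asymptotic_stability
    (φ γ : ℝ → ℝ)
    (hφ : Differentiable ℝ φ)
    (K : NNReal) (hγ_lip : LipschitzWith K γ)
    (hγ_mono : StrictMono γ)
    (hγ_zero : γ 0 = 0)
    (hineq : ∀ t ≥ (0 : ℝ), deriv φ t ≥ -γ (φ t)) :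
    ∀ ε > (0 : ℝ), ∃ T ≥ (0 : ℝ), ∀ t ≥ T, φ t > -ε := by
  intro ε hε
  set δ := ε / 2 with hδ_def
  have hδ : 0 < δ := half_pos hε
  have hγδ : γ (-δ) < 0 := hγ_zero ▸ hγ_mono (neg_lt_zero.mpr hδ)
  obtain ⟨T, hT, hφT⟩ : ∃ T ≥ (0 : ℝ), -δ ≤ φ T := by
    by_contra! hneg
    have hgrowth : ∀ t ≥ (0 : ℝ), -γ (-δ) * (t - 0) ≤ φ t - φ 0 := fun t ht =>
      (convex_Ici (0 : ℝ)).mul_sub_le_image_sub_of_le_deriv hφ.continuous.continuousOn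
        hφ.differentiableOn
        (fun x hx => by
          have hx : 0 ≤ x := interior_subset hx
          have := hineq x hx
          have := hγ_mono (hneg x hx)
          linarith) 0 Set.self_mem_Ici t ht ht
    have hφ0 := hneg 0 le_rfl
    have ht : 0 ≤ φ 0 / γ (-δ) := div_nonneg_of_nonpos (by linarith) hγδ.le
    have h := hgrowth _ ht
    rw [sub_zero, neg_mul, mul_div_cancel₀ _ hγδ.ne] at h
    linarith [hneg _ ht]
  refine ⟨T, hT, fun t ht => ?_⟩
  have hbound : -φ t ≤ δ :=
    image_le_of_deriv_right_lt_deriv_boundary (f := fun x => -φ x) (f' := fun x => -deriv φ x)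
      (B := fun _ => δ) (B' := fun _ => 0) hφ.continuous.neg.continuousOn
      (fun x _ => (hφ x).hasDerivAt.neg.hasDerivWithinAt) (by linarith)
      (fun x => hasDerivAt_const x δ)
      (fun x hx hfx => by
        have := hineq x (hT.trans hx.1)
        rw [show φ x = -δ by linarith] at this
        linarith) (Set.right_mem_Icc.mpr ht)
  linarith
end

section
/- (Key matrix identity in the proof of Proposition 6, Eq. (37).) Let B be a real p × n matrix, K̄ a real r × p matrix, and l > 0. Set M = I + l B Bᵀ and S = K̄ B (I + l Bᵀ B)⁻¹ Bᵀ K̄ᵀ, and assume S is invertible. Define Ã = M⁻¹ + M⁻¹ K̄ᵀ (l S)⁻¹ K̄ M⁻¹. Then K̄ᵀ K̄ B Bᵀ Ã = (1/l) K̄ᵀ K̄. -/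
open Matrix

/-- The regularized Gram matrix `I + l A Aᵀ` is invertible for `0 ≤ l`. -/
lemma isUnit_det_one_add_smul_mul_transpose {m k : Type*} [Fintype m] [DecidableEq m] [Fintype k]
    (A : Matrix m k ℝ) {l : ℝ} (hl : 0 ≤ l) : IsUnit (1 + l • (A * Aᵀ)).det := by
  have hA : (A * Aᵀ).PosSemidef := by
    simpa only [conjTranspose_eq_transpose_of_trivial] using posSemidef_self_mul_conjTranspose A
  exact (isUnit_iff_isUnit_det _).mp (PosDef.one.add_posSemidef (hA.smul hl)).isUnit

/-- The push-through identity `B (I + l Bᵀ B)⁻¹ Bᵀ = B Bᵀ (I + l B Bᵀ)⁻¹`. -/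
lemma mul_inv_one_add_smul_mul_transpose {m k : Type*} [Fintype m] [DecidableEq m]
    [Fintype k] [DecidableEq k] (B : Matrix m k ℝ) {l : ℝ} (hl : 0 ≤ l) :
    B * (1 + l • (Bᵀ * B))⁻¹ * Bᵀ = B * Bᵀ * (1 + l • (B * Bᵀ))⁻¹ := by
  have hM := isUnit_det_one_add_smul_mul_transpose B hl
  have hN : IsUnit (1 + l • (Bᵀ * B)).det := by
    simpa only [transpose_transpose] using isUnit_det_one_add_smul_mul_transpose Bᵀ hl
  have hcomm : Bᵀ * (1 + l • (B * Bᵀ)) = (1 + l • (Bᵀ * B)) * Bᵀ := by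
    simp [Matrix.mul_add, Matrix.add_mul, Matrix.mul_assoc]
  have hinv : (1 + l • (Bᵀ * B))⁻¹ * Bᵀ = Bᵀ * (1 + l • (B * Bᵀ))⁻¹ := by
    rw [← mul_nonsing_inv_cancel_right _ ((1 + l • (Bᵀ * B))⁻¹ * Bᵀ) hM,
      Matrix.mul_assoc _ Bᵀ, hcomm, nonsing_inv_mul_cancel_left _ _ hN]
  rw [Matrix.mul_assoc, hinv, Matrix.mul_assoc]

/-- Key matrix identity in the proof of Proposition 6 (Eq. (37)): with
`M = I + l B Bᵀ`, `S = K̄ B (I + l Bᵀ B)⁻¹ Bᵀ K̄ᵀ` invertible, and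
`Ã = M⁻¹ + M⁻¹ K̄ᵀ (l S)⁻¹ K̄ M⁻¹`, one has `K̄ᵀ K̄ B Bᵀ Ã = (1/l) K̄ᵀ K̄`. -/
theorem key_identity_prioritized_stability
    (p n r : ℕ)
    (B : Matrix (Fin p) (Fin n) ℝ)
    (Kbar : Matrix (Fin r) (Fin p) ℝ)
    (l : ℝ) (hl : 0 < l)
    (Mmat : Matrix (Fin p) (Fin p) ℝ)
    (hM : Mmat = (1 : Matrix (Fin p) (Fin p) ℝ) + l • (B * Bᵀ))
    (S : Matrix (Fin r) (Fin r) ℝ)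
    (hSdef : S = Kbar * B * ((1 : Matrix (Fin n) (Fin n) ℝ) + l • (Bᵀ * B))⁻¹ *
      Bᵀ * Kbarᵀ)
    (hS : IsUnit S)
    (Atilde : Matrix (Fin p) (Fin p) ℝ)
    (hA : Atilde = Mmat⁻¹ + Mmat⁻¹ * Kbarᵀ * (l • S)⁻¹ * Kbar * Mmat⁻¹) :
    Kbarᵀ * Kbar * (B * Bᵀ) * Atilde = (1 / l) • (Kbarᵀ * Kbar) := by
  have hMu : IsUnit Mmat.det := hM ▸ isUnit_det_one_add_smul_mul_transpose B hl.le
  have hSu : IsUnit S.det := (isUnit_iff_isUnit_det S).mp hS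
  have hS' : S = Kbar * (B * Bᵀ) * Mmat⁻¹ * Kbarᵀ := by
    rw [hSdef, hM, Matrix.mul_assoc Kbar (B * Bᵀ), ← mul_inv_one_add_smul_mul_transpose B hl.le]
    simp only [Matrix.mul_assoc]
  have hlS : (l • S)⁻¹ = l⁻¹ • S⁻¹ := by
    refine inv_eq_right_inv ?_
    rw [smul_mul_smul_comm, mul_inv_cancel₀ hl.ne', mul_nonsing_inv S hSu, one_smul]
  have hG : B * Bᵀ + l⁻¹ • (1 : Matrix (Fin p) (Fin p) ℝ) = l⁻¹ • Mmat := by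
    rw [hM, smul_add, smul_smul, inv_mul_cancel₀ hl.ne', one_smul, add_comm]
  have hKA : Kbar * (B * Bᵀ) * Atilde = l⁻¹ • Kbar :=
    calc Kbar * (B * Bᵀ) * Atilde
        = Kbar * (B * Bᵀ) * Mmat⁻¹ +
            l⁻¹ • ((Kbar * (B * Bᵀ) * Mmat⁻¹ * Kbarᵀ) * S⁻¹ * (Kbar * Mmat⁻¹)) := by
          rw [hA, hlS]
          simp only [Matrix.mul_add, Matrix.mul_assoc, Matrix.mul_smul, Matrix.smul_mul]
      _ = Kbar * (B * Bᵀ + l⁻¹ • (1 : Matrix (Fin p) (Fin p) ℝ)) * Mmat⁻¹ := by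
          rw [← hS', mul_nonsing_inv S hSu, Matrix.one_mul, Matrix.mul_add, Matrix.add_mul,
            Matrix.mul_smul, Matrix.mul_one, Matrix.smul_mul]
      _ = l⁻¹ • Kbar := by
          rw [hG, Matrix.mul_smul, Matrix.smul_mul, mul_nonsing_inv_cancel_right _ _ hMu]
  rw [Matrix.mul_assoc Kbarᵀ, Matrix.mul_assoc Kbarᵀ, hKA, Matrix.mul_smul, one_div]
end
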